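/- Let (X,G) be a G-system with G a countable discrete amenable Abelian group, and let 𝓕 = {f_E}_{E∈𝓕(G)} be a sub-additive potential on (X,G). Let (F_n) be a Følner sequence of G consisting of tiles of G. Let (ν_n) be a sequence of Borel probability measures on X and set μ_n := (1/|F_n|) Σ_{g∈F_n} g·ν_n (where g·ν denotes the pushforward of ν under the map x ↦ gx). Suppose that μ_{n_i} → μ in the weak* topology for some subsequence (n_i). Then μ is G-invariant, and limsup_{i→∞} (1/|F_{n_i}|) ∫_X f_{F_{n_i}} dν_{n_i} ≤ 𝓕_*(μ). -/

import Mathlib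

open MeasureTheory Filter Topology
open scoped Pointwise symmDiff Classical ENNReal

/-- A Følner sequence for a countable discrete group `G`: a sequence of nonempty finite
subsets `F n` of `G` such that `|gF_n △ F_n| / |F_n| → 0` for every `g ∈ G`. -/
def FolnerSeq (G : Type*) [Group G] [DecidableEq G] (F : ℕ → Finset G) : Prop :=
  (∀ n, (F n).Nonempty) ∧
    ∀ g : G, Tendsto (fun n => (((g • F n) ∆ F n).card : ℝ) / (F n).card) atTop (𝓝 0)

/-- The family of sets `𝓥` is finer than the family `𝓦`. -/
def IsFinerFam {X : Type*} (V W : Set (Set X)) : Prop := ∀ A ∈ V, ∃ B ∈ W, A ⊆ B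

/-- The cover `𝓤_E = ⋁_{g ∈ E} g⁻¹ 𝓤` associated to a finite cover `𝓤` and `E ∈ 𝓕(G)`. -/
def DynRefine (G : Type*) {X : Type*} [SMul G X] (U : Finset (Set X)) (E : Finset G) :
    Set (Set X) :=
  {V | ∃ u : G → Set X, (∀ g ∈ E, u g ∈ U) ∧ V = ⋂ g ∈ E, (fun x => g • x) ⁻¹' u g}

/-- `P_E(G,𝓕;𝓤)`: the infimum of `Σ_{V ∈ 𝓥} sup_{x ∈ V} e^{f_E(x)}` over all finite Borel
covers `𝓥` of `X` finer than `𝓤_E`. -/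
noncomputable def CoverPressure (G : Type*) {X : Type*} [SMul G X] [MeasurableSpace X]
    (f : Finset G → X → ℝ) (U : Finset (Set X)) (E : Finset G) : ℝ :=
  sInf {S : ℝ | ∃ V : Finset (Set X), (∀ A ∈ V, MeasurableSet A) ∧
    ⋃₀ (↑V : Set (Set X)) = Set.univ ∧ IsFinerFam (↑V) (DynRefine G U E) ∧
    S = ∑ A ∈ V, ⨆ x ∈ A, Real.exp (f E x)}

/-- A finite Borel partition of `X`. -/
def IsBorelPartition {X : Type*} [MeasurableSpace X] (P : Finset (Set X)) : Prop :=
  (∀ A ∈ P, MeasurableSet A) ∧ ⋃₀ (↑P : Set (Set X)) = Set.univ ∧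
    (↑P : Set (Set X)).PairwiseDisjoint id

/-- `H_μ(α) = -Σ_{A ∈ α} μ(A) log μ(A)`. -/
noncomputable def PartEnt {X : Type*} [MeasurableSpace X] (μ : Measure X)
    (P : Finset (Set X)) : ℝ :=
  ∑ A ∈ P, Real.negMulLog (μ A).toReal

/-- `H_μ(𝓒)`: the infimum of `H_μ(α)` over finite Borel partitions `α` finer than `𝓒`. -/
noncomputable def CoverEnt {X : Type*} [MeasurableSpace X] (μ : Measure X)
    (C : Set (Set X)) : ℝ :=
  sInf {h : ℝ | ∃ P : Finset (Set X), IsBorelPartition P ∧ IsFinerFam (↑P) C ∧ h = PartEnt μ P}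

/-- `μ ∈ M(X,G)`: a `G`-invariant Borel probability measure. -/
def GInvariant (G : Type*) {X : Type*} [SMul G X] [MeasurableSpace X] (μ : Measure X) : Prop :=
  IsProbabilityMeasure μ ∧ ∀ g : G, Measure.map (fun x => g • x) μ = μ

/-- `μ ∈ M^e(X,G)`: an ergodic `G`-invariant Borel probability measure. -/
def GErgodic (G : Type*) {X : Type*} [SMul G X] [MeasurableSpace X] (μ : Measure X) : Prop :=
  GInvariant G μ ∧ ∀ s : Set X, MeasurableSet s → (∀ g : G, (fun x => g • x) ⁻¹' s = s) →
    μ s = 0 ∨ μ s = 1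

/-- A sub-additive potential on `(X,G)`: a family of continuous functions satisfying
(C1) subadditivity on disjoint unions, (C2) `f_{Eg}(x) = f_E(gx)`, and
(C3) `sup (f_E - f_{E ∪ {g}}) < ∞`. -/
def SubaddPotential (G : Type*) {X : Type*} [Group G] [DecidableEq G] [SMul G X]
    [TopologicalSpace X] (f : Finset G → X → ℝ) : Prop :=
  (∀ E : Finset G, Continuous (f E)) ∧
  (∀ (E F : Finset G) (x : X), E.Nonempty → F.Nonempty → Disjoint E F →
    f (E ∪ F) x ≤ f E x + f F x) ∧
  (∀ (E : Finset G) (g : G) (x : X), f (E.image fun a => a * g) x = f E (g • x)) ∧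
  (∃ C : ℝ, ∀ (E : Finset G) (g : G) (x : X), E.Nonempty → f E x - f (insert g E) x ≤ C)

/-- The extension of a set function by `0` at the empty set. -/
noncomputable def extendByZero {G X : Type*} (f : Finset G → X → ℝ) (E : Finset G) (x : X) : ℝ :=
  if E = ∅ then 0 else f E x

lemma extendByZero_of_nonempty {G X : Type*} {f : Finset G → X → ℝ} {E : Finset G}
    (hE : E.Nonempty) (x : X) : extendByZero f E x = f E x := by
  simp [extendByZero, hE.ne_empty]

section SubaddPotential

variable {G X : Type*} [CommGroup G] [DecidableEq G] [TopologicalSpace X] [MulAction G X]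
  {f : Finset G → X → ℝ}

lemma SubaddPotential.extendByZero_union_le (hf : SubaddPotential G f) {E F : Finset G}
    (h : Disjoint E F) (x : X) :
    extendByZero f (E ∪ F) x ≤ extendByZero f E x + extendByZero f F x := by
  rcases E.eq_empty_or_nonempty with rfl | hE
  · rw [Finset.empty_union]
    simp [extendByZero]
  rcases F.eq_empty_or_nonempty with rfl | hF
  · rw [Finset.union_empty]
    simp [extendByZero]
  rw [extendByZero_of_nonempty hE, extendByZero_of_nonempty hF,
    extendByZero_of_nonempty (hE.mono Finset.subset_union_left)]
  exact hf.2.1 E F x hE hF h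

lemma SubaddPotential.extendByZero_biUnion_le (hf : SubaddPotential G f) {ι : Type*}
    [DecidableEq ι] (S : Finset ι) (u : ι → Finset G)
    (h : (S : Set ι).PairwiseDisjoint u) (x : X) :
    extendByZero f (S.biUnion u) x ≤ ∑ s ∈ S, extendByZero f (u s) x := by
  induction S using Finset.induction_on with
  | empty => simp [extendByZero]
  | insert a S ha ih =>
    rw [Finset.biUnion_insert, Finset.sum_insert ha]
    refine (hf.extendByZero_union_le ?_ x).trans ?_
    · rw [Finset.disjoint_biUnion_right]
      intro b hb
      refine h (by simp) (by simp [hb]) ?_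
      rintro rfl
      exact ha hb
    · gcongr
      exact ih (h.subset (by simp))

lemma SubaddPotential.singleton_eq (hf : SubaddPotential G f) (g : G) (x : X) :
    f {g} x = f {1} (g • x) := by
  simpa using hf.2.2.1 {1} g x

lemma SubaddPotential.extendByZero_le_card_mul (hf : SubaddPotential G f) {M : ℝ}
    (hM : ∀ x, |f {1} x| ≤ M) (E : Finset G) (x : X) :
    extendByZero f E x ≤ M * E.card := by
  have h := hf.extendByZero_biUnion_le E (fun g => {g})
    (fun a _ b _ hab => by simpa [Function.onFun] using hab) x
  rw [Finset.biUnion_singleton_eq_self] at h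
  refine h.trans ?_
  rw [mul_comm, ← nsmul_eq_mul]
  refine Finset.sum_le_card_nsmul _ _ _ fun g _ => ?_
  rw [extendByZero_of_nonempty (by simp), hf.singleton_eq]
  exact (le_abs_self _).trans (hM _)

lemma SubaddPotential.exists_neg_mul_card_le [CompactSpace X] [Nonempty X]
    (hf : SubaddPotential G f) :
    ∃ A : ℝ, ∀ E : Finset G, E.Nonempty → ∀ x, -(A * E.card) ≤ f E x := by
  obtain ⟨C, hC⟩ := hf.2.2.2
  obtain ⟨M, hM⟩ := (isCompact_range (hf.1 {1})).isBounded.exists_norm_le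
  replace hM : ∀ x, |f {1} x| ≤ M := fun x => hM _ ⟨x, rfl⟩
  obtain ⟨x₀⟩ := ‹Nonempty X›
  have hC0 : 0 ≤ C := by simpa using hC {1} 1 x₀ (by simp)
  have hM0 : 0 ≤ M := (abs_nonneg _).trans (hM x₀)
  refine ⟨M + C, fun E hE x => ?_⟩
  induction hE using Finset.Nonempty.cons_induction with
  | singleton a =>
    have := neg_abs_le (f {1} (a • x))
    have := hM (a • x)
    rw [hf.singleton_eq]
    simp
    linarith
  | cons a s ha hs ih =>
    have := hC s a x hs
    rw [Finset.cons_eq_insert, Finset.card_insert_of_notMem ha]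
    push_cast
    nlinarith

/-- Averaging the subadditivity inequality over the translates of a tiling by `T`. -/
lemma SubaddPotential.card_mul_le_sum_add (hf : SubaddPotential G f) {M : ℝ}
    (hM : ∀ x, |f {1} x| ≤ M) {T E D : Finset G} (hT : T.Nonempty) (hE : E.Nonempty)
    (hD : ∀ s ∈ D, ∀ t ∈ T, t * s ∈ E) {Ctr : Set G}
    (hdisj : Ctr.PairwiseDisjoint fun c => (fun t => t * c) '' (↑T : Set G))
    (hcov : ⋃ c ∈ Ctr, (fun t => t * c) '' (↑T : Set G) = Set.univ) (x : X) :
    T.card * f E x ≤ ∑ s ∈ D, f T (s • x) + M * (T.card * (E.card - D.card)) := by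
  have huniq : ∀ s : G, ∃! t, t ∈ T ∧ s * t⁻¹ ∈ Ctr := by
    intro s
    have hs : s ∈ ⋃ c ∈ Ctr, (fun t => t * c) '' (↑T : Set G) := hcov ▸ Set.mem_univ s
    simp only [Set.mem_iUnion, Set.mem_image] at hs
    obtain ⟨c, hc, t, ht, rfl⟩ := hs
    refine ⟨t, ⟨ht, by simpa using hc⟩, ?_⟩
    rintro t' ⟨ht', hc'⟩
    have := hdisj.elim_set hc hc' (t * c) ⟨t, ht, rfl⟩ ⟨t', ht', by simp [mul_comm]⟩
    rw [eq_mul_inv_iff_mul_eq, mul_comm] at this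
    exact mul_right_cancel this
  have hsum : ∀ φ : G → ℝ, ∑ t ∈ T, ∑ s ∈ D with s * t⁻¹ ∈ Ctr, φ s = ∑ s ∈ D, φ s := by
    intro φ
    simp_rw [Finset.sum_filter]
    rw [Finset.sum_comm]
    refine Finset.sum_congr rfl fun s _ => ?_
    obtain ⟨t, ⟨ht, htc⟩, hu⟩ := huniq s
    rw [Finset.sum_eq_single_of_mem t ht, if_pos htc]
    intro b hb hbt
    exact if_neg fun h => hbt (hu b ⟨hb, h⟩)
  have hone : ∀ t ∈ T, f E x ≤ ∑ s ∈ D with s * t⁻¹ ∈ Ctr, f T (s • x) +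
      M * (E.card - T.card * ∑ s ∈ D with s * t⁻¹ ∈ Ctr, (1 : ℝ)) := by
    intro t _
    set S := D.filter fun s => s * t⁻¹ ∈ Ctr with hS
    set u : G → Finset G := fun s => T.image fun a => a * s with hu
    have hpd : (S : Set G).PairwiseDisjoint u := by
      intro s hs s' hs' hne
      simp only [hS, Finset.coe_filter, Set.mem_ofPred_eq] at hs hs'
      rw [Function.onFun, Finset.disjoint_left]
      intro y hy hy'
      simp only [hu, Finset.mem_image] at hy hy'
      obtain ⟨a, ha, rfl⟩ := hy
      obtain ⟨b, hb, hab⟩ := hy'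
      refine hne (mul_right_cancel (hdisj.elim_set hs.2 hs'.2 (a * s * t⁻¹)
        ⟨a, ha, by simp [mul_assoc]⟩ ⟨b, hb, ?_⟩))
      simp [← hab, mul_assoc]
    have hsub : S.biUnion u ⊆ E := by
      intro y hy
      simp only [hu, hS, Finset.mem_biUnion, Finset.mem_image, Finset.mem_filter] at hy
      obtain ⟨s, hs, a, ha, rfl⟩ := hy
      exact hD s hs.1 a ha
    have hcard : ((S.biUnion u).card : ℝ) = T.card * ∑ s ∈ S, (1 : ℝ) := by
      rw [Finset.card_biUnion fun a ha b hb hab => hpd ha hb hab]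
      push_cast
      rw [Finset.mul_sum]
      refine Finset.sum_congr rfl fun s _ => ?_
      rw [Finset.card_image_of_injective _ (mul_left_injective s), mul_one]
    have h₁ := hf.extendByZero_union_le (E := S.biUnion u) (F := E \ S.biUnion u)
      Finset.disjoint_sdiff x
    rw [Finset.union_sdiff_of_subset hsub, extendByZero_of_nonempty hE] at h₁
    have h₂ := hf.extendByZero_biUnion_le S u hpd x
    have h₃ : ∑ s ∈ S, extendByZero f (u s) x = ∑ s ∈ S, f T (s • x) :=
      Finset.sum_congr rfl fun s _ => by
        rw [extendByZero_of_nonempty (hT.image _), hf.2.2.1]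
    have h₄ := hf.extendByZero_le_card_mul hM (E \ S.biUnion u) x
    rw [Finset.cast_card_sdiff hsub, hcard] at h₄
    linarith
  have := Finset.sum_le_sum hone
  rw [Finset.sum_const, nsmul_eq_mul, Finset.sum_add_distrib, hsum, ← Finset.mul_sum,
    Finset.sum_sub_distrib, ← Finset.mul_sum, hsum] at this
  simp only [Finset.sum_const, nsmul_eq_mul, mul_one] at this
  linarith

/-- The average of `f E` is bounded by the ergodic sum of `f T` over `E`, up to a term controlled
by the `T`-boundary of `E`. -/
lemma SubaddPotential.card_mul_le_sum_add_boundary (hf : SubaddPotential G f) {M K : ℝ}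
    (hM : ∀ x, |f {1} x| ≤ M) {T E : Finset G} (hK : ∀ x, |f T x| ≤ K) (hT : T.Nonempty)
    (hE : E.Nonempty) {Ctr : Set G}
    (hdisj : Ctr.PairwiseDisjoint fun c => (fun t => t * c) '' (↑T : Set G))
    (hcov : ⋃ c ∈ Ctr, (fun t => t * c) '' (↑T : Set G) = Set.univ) (x : X) :
    T.card * f E x ≤ ∑ s ∈ E, f T (s • x) +
      (K + M * T.card) * ∑ t ∈ T, (((t⁻¹ • E) ∆ E).card : ℝ) := by
  set D := E.filter fun s => ∀ t ∈ T, t * s ∈ E with hD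
  have h := hf.card_mul_le_sum_add hM hT hE (D := D)
    (fun s hs => (Finset.mem_filter.1 hs).2) hdisj hcov x
  have hsub : D ⊆ E := Finset.filter_subset _ _
  have hM0 : 0 ≤ M := (abs_nonneg _).trans (hM x)
  have hK0 : 0 ≤ K := (abs_nonneg _).trans (hK x)
  have hcard : ((E \ D).card : ℝ) ≤ ∑ t ∈ T, (((t⁻¹ • E) ∆ E).card : ℝ) := by
    have : E \ D ⊆ T.biUnion fun t => (t⁻¹ • E) ∆ E := by
      intro s hs
      simp only [hD, Finset.mem_sdiff, Finset.mem_filter, not_and, not_forall] at hs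
      obtain ⟨t, ht, hts⟩ := hs.2 hs.1
      refine Finset.mem_biUnion.2 ⟨t, ht, Finset.mem_symmDiff.2 (Or.inr ⟨hs.1, ?_⟩)⟩
      rwa [Finset.mem_inv_smul_finset_iff]
    exact_mod_cast (Finset.card_le_card this).trans Finset.card_biUnion_le
  have hsum : ∑ s ∈ D, f T (s • x) ≤ ∑ s ∈ E, f T (s • x) + K * (E \ D).card := by
    rw [← Finset.sum_sdiff hsub]
    have : ∑ s ∈ E \ D, -f T (s • x) ≤ (E \ D).card • K :=
      Finset.sum_le_card_nsmul _ _ _ fun s _ => (neg_le_abs _).trans (hK _)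
    rw [Finset.sum_neg_distrib, nsmul_eq_mul] at this
    linarith
  rw [← Finset.cast_card_sdiff hsub] at h
  have h₁ := mul_le_mul_of_nonneg_left hcard (add_nonneg hK0 (mul_nonneg hM0 T.card.cast_nonneg))
  linarith

end SubaddPotential

lemma abs_sum_sub_sum_le_mul_card_symmDiff {ι : Type*} [DecidableEq ι] (A B : Finset ι)
    (a : ι → ℝ) {K : ℝ} (ha : ∀ i, |a i| ≤ K) :
    |∑ i ∈ A, a i - ∑ i ∈ B, a i| ≤ K * (A ∆ B).card := by
  have hA := Finset.sum_inter_add_sum_sdiff A B a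
  have hB := Finset.sum_inter_add_sum_sdiff B A a
  rw [Finset.inter_comm] at hB
  have h₁ : |∑ i ∈ A \ B, a i| ≤ (A \ B).card • K :=
    (Finset.abs_sum_le_sum_abs _ _).trans (Finset.sum_le_card_nsmul _ _ _ fun i _ => ha i)
  have h₂ : |∑ i ∈ B \ A, a i| ≤ (B \ A).card • K :=
    (Finset.abs_sum_le_sum_abs _ _).trans (Finset.sum_le_card_nsmul _ _ _ fun i _ => ha i)
  have hcard : ((A ∆ B).card : ℝ) = (A \ B).card + (B \ A).card := by
    rw [symmDiff_def, Finset.sup_eq_union, Finset.card_union_of_disjoint disjoint_sdiff_sdiff]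
    push_cast
    rfl
  rw [nsmul_eq_mul] at h₁ h₂
  rw [hcard, abs_le]
  rw [abs_le] at h₁ h₂
  constructor <;> linarith

lemma integral_average_map {G X : Type*} [Group G] [MetricSpace X] [CompactSpace X]
    [MeasurableSpace X] [BorelSpace X] [MulAction G X]
    (hact : ∀ g : G, Continuous fun x : X => g • x) (E : Finset G)
    (ν : Measure X) [IsProbabilityMeasure ν] {φ : X → ℝ} (hφ : Continuous φ) :
    ∫ x, φ x ∂((E.card : ℝ≥0∞)⁻¹ • ∑ g ∈ E, Measure.map (fun x => g • x) ν) =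
      (∑ g ∈ E, ∫ x, φ (g • x) ∂ν) / E.card := by
  have hφint : ∀ g ∈ E, Integrable φ (Measure.map (fun x => g • x) ν) := fun g _ => by
    have := Measure.isProbabilityMeasure_map (μ := ν) (hact g).aemeasurable
    exact hφ.integrable_of_hasCompactSupport (HasCompactSupport.of_compactSpace φ)
  rw [integral_smul_measure, integral_finsetSum_measure hφint]
  simp only [ENNReal.toReal_inv, ENNReal.toReal_natCast, smul_eq_mul]
  rw [div_eq_inv_mul]
  congr 1
  refine Finset.sum_congr rfl fun g _ => ?_
  exact integral_map (hact g).aemeasurable hφ.aestronglyMeasurable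

lemma tendsto_sum_integral_smul_sub {G X : Type*} [Group G] [DecidableEq G]
    [TopologicalSpace X] [CompactSpace X] [MeasurableSpace X] [MulAction G X]
    {F : ℕ → Finset G} (hF : FolnerSeq G F) (ν : ℕ → Measure X)
    [∀ n, IsProbabilityMeasure (ν n)] {φ : X → ℝ} (hφ : Continuous φ) (h : G) :
    Tendsto (fun n => (∑ g ∈ F n, ∫ x, φ (h • g • x) ∂ν n) / (F n).card -
      (∑ g ∈ F n, ∫ x, φ (g • x) ∂ν n) / (F n).card) atTop (𝓝 0) := by
  obtain ⟨K, hK⟩ := (isCompact_range hφ).isBounded.exists_norm_le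
  replace hK : ∀ x, ‖φ x‖ ≤ K := fun x => hK _ ⟨x, rfl⟩
  refine squeeze_zero_norm (a := fun n => K * ((((h • F n) ∆ F n).card : ℝ) / (F n).card))
    (fun n => ?_) (by simpa using (hF.2 h).const_mul K)
  have hsum : ∑ g ∈ F n, ∫ x, φ (h • g • x) ∂ν n = ∑ g ∈ h • F n, ∫ x, φ (g • x) ∂ν n := by
    rw [← Finset.image_smul, Finset.sum_image fun a _ b _ hab => smul_left_cancel h hab]
    simp [mul_smul]
  rw [hsum, ← sub_div, norm_div, mul_div_assoc', Real.norm_natCast]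
  gcongr
  refine abs_sum_sub_sum_le_mul_card_symmDiff _ _ _ fun g => ?_
  simpa using norm_integral_le_of_norm_le_const (μ := ν n) (.of_forall fun x => hK (g • x))

section Averages

variable {G X : Type*} [CommGroup G] [DecidableEq G]
  [MetricSpace X] [CompactSpace X] [MeasurableSpace X] [BorelSpace X] [MulAction G X]

lemma gInvariant_of_tendsto_average (hact : ∀ g : G, Continuous fun x : X => g • x)
    {F : ℕ → Finset G} (hF : FolnerSeq G F) {ν : ℕ → Measure X}
    (hν : ∀ n, IsProbabilityMeasure (ν n)) {ns : ℕ → ℕ} (hns : StrictMono ns) {μ : Measure X}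
    (hconv : ∀ φ : X → ℝ, Continuous φ → Tendsto (fun i =>
      (∑ g ∈ F (ns i), ∫ x, φ (g • x) ∂ν (ns i)) / (F (ns i)).card) atTop (𝓝 (∫ x, φ x ∂μ))) :
    GInvariant G μ := by
  have hμ : IsProbabilityMeasure μ := by
    have h := hconv (fun _ => 1) continuous_const
    have hone : ∀ i, (∑ g ∈ F (ns i), ∫ _, (1 : ℝ) ∂ν (ns i)) / (F (ns i)).card = 1 := by
      intro i
      simp [(hF.1 (ns i)).ne_empty]
    simp only [hone] at h
    have h1 := tendsto_nhds_unique tendsto_const_nhds h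
    rw [integral_const, smul_eq_mul, mul_one] at h1
    exact ⟨by simpa [Measure.real] using (ENNReal.toReal_eq_one_iff _).1 h1.symm⟩
  refine ⟨hμ, fun h => ?_⟩
  have := Measure.isProbabilityMeasure_map (μ := μ) (hact h).aemeasurable
  refine ext_of_forall_integral_eq_of_IsFiniteMeasure fun φ => ?_
  rw [integral_map (hact h).aemeasurable φ.continuous.aestronglyMeasurable]
  have h₁ := (hconv (fun x => φ (h • x)) (φ.continuous.comp (hact h))).sub
    (hconv φ φ.continuous)
  have h₂ := (tendsto_sum_integral_smul_sub hF ν φ.continuous h).comp hns.tendsto_atTop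
  exact sub_eq_zero.1 (tendsto_nhds_unique h₁ h₂)

lemma SubaddPotential.limsup_le_of_tile (hact : ∀ g : G, Continuous fun x : X => g • x)
    {f : Finset G → X → ℝ} (hf : SubaddPotential G f)
    {F : ℕ → Finset G} (hF : FolnerSeq G F) {ν : ℕ → Measure X}
    (hν : ∀ n, IsProbabilityMeasure (ν n)) {ns : ℕ → ℕ} (hns : StrictMono ns) {μ : Measure X}
    (hconv : ∀ φ : X → ℝ, Continuous φ → Tendsto (fun i =>
      (∑ g ∈ F (ns i), ∫ x, φ (g • x) ∂ν (ns i)) / (F (ns i)).card) atTop (𝓝 (∫ x, φ x ∂μ)))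
    {T : Finset G} (hT : T.Nonempty) {Ctr : Set G}
    (hdisj : Ctr.PairwiseDisjoint fun c => (fun t => t * c) '' (↑T : Set G))
    (hcov : ⋃ c ∈ Ctr, (fun t => t * c) '' (↑T : Set G) = Set.univ) :
    limsup (fun i => (∫ x, f (F (ns i)) x ∂(ν (ns i))) / (F (ns i)).card) atTop ≤
      (∫ x, f T x ∂μ) / T.card := by
  have hφint : ∀ (n : ℕ) {φ : X → ℝ}, Continuous φ → Integrable φ (ν n) := fun n φ hφ =>
    hφ.integrable_of_hasCompactSupport (HasCompactSupport.of_compactSpace φ)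
  have hpos : ∀ n, (0 : ℝ) < (F n).card := fun n => by
    exact_mod_cast Finset.card_pos.2 (hF.1 n)
  have hTpos : (0 : ℝ) < T.card := by exact_mod_cast Finset.card_pos.2 hT
  have hX : Nonempty X := nonempty_of_isProbabilityMeasure (ν 0)
  obtain ⟨A, hA⟩ := hf.exists_neg_mul_card_le
  obtain ⟨M, hM⟩ := (isCompact_range (hf.1 {1})).isBounded.exists_norm_le
  replace hM : ∀ x, |f {1} x| ≤ M := fun x => hM _ ⟨x, rfl⟩
  obtain ⟨K, hK⟩ := (isCompact_range (hf.1 T)).isBounded.exists_norm_le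
  replace hK : ∀ x, |f T x| ≤ K := fun x => hK _ ⟨x, rfl⟩
  set v : ℕ → ℝ := fun i => ((∑ g ∈ F (ns i), ∫ x, f T (g • x) ∂ν (ns i)) / (F (ns i)).card +
    (K + M * T.card) * ∑ t ∈ T, (((t⁻¹ • F (ns i)) ∆ F (ns i)).card : ℝ) / (F (ns i)).card) /
      T.card with hv
  have hbd : Tendsto (fun n => ∑ t ∈ T, (((t⁻¹ • F n) ∆ F n).card : ℝ) / (F n).card)
      atTop (𝓝 0) := by
    simpa using tendsto_finsetSum T fun t _ => hF.2 t⁻¹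
  have hvlim : Tendsto v atTop (𝓝 ((∫ x, f T x ∂μ) / T.card)) := by
    have := ((hconv _ (hf.1 T)).add
      ((hbd.comp hns.tendsto_atTop).const_mul (K + M * T.card))).div_const (T.card : ℝ)
    simpa using this
  rw [← hvlim.limsup_eq]
  refine limsup_le_limsup (.of_forall fun i => ?_) ?_ hvlim.isBoundedUnder_le
  · have hle : ∫ x, T.card * f (F (ns i)) x ∂ν (ns i) ≤
        ∫ x, (∑ s ∈ F (ns i), f T (s • x) + (K + M * T.card) *
          ∑ t ∈ T, (((t⁻¹ • F (ns i)) ∆ F (ns i)).card : ℝ)) ∂ν (ns i) := by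
      refine integral_mono (hφint _ (continuous_const.mul (hf.1 _))) (hφint _ ?_) fun x =>
        hf.card_mul_le_sum_add_boundary hM hK hT (hF.1 _) hdisj hcov x
      exact (continuous_finsetSum _ fun s _ => (hf.1 T).comp (hact s)).add continuous_const
    have hT_int : ∀ s ∈ F (ns i), Integrable (fun x => f T (s • x)) (ν (ns i)) := fun s _ =>
      hφint _ ((hf.1 T).comp (hact s))
    rw [integral_const_mul, integral_add (integrable_finsetSum _ hT_int) (integrable_const _),
      integral_finsetSum _ hT_int, integral_const, probReal_univ, one_smul] at hle
    simp only [hv]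
    rw [← Finset.sum_div, le_div_iff₀ hTpos, mul_div_assoc', ← add_div, div_mul_eq_mul_div]
    gcongr
    rw [mul_comm]
    exact hle
  · refine IsBoundedUnder.isCoboundedUnder_le ⟨-A, eventually_map.2 (.of_forall fun i => ?_)⟩
    change -A ≤ _
    rw [le_div_iff₀ (hpos _), neg_mul]
    calc -(A * (F (ns i)).card) = ∫ _, -(A * (F (ns i)).card) ∂ν (ns i) := by simp
      _ ≤ _ := integral_mono (integrable_const _) (hφint _ (hf.1 _)) (hA _ (hF.1 _))

end Averages

/-- **Upper bound on averaged integrals via the limit measure** (Lemma 3.6).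
Let `(X,G)` be a `G`-system with `G` a countable amenable Abelian group, `𝓕` a sub-additive
potential, `(F_n)` a Følner sequence consisting of tiles of `G`, `(ν_n)` Borel probability
measures on `X`, and `μ_n = (1/|F_n|) Σ_{g∈F_n} g ν_n`. If `μ_{n_i} → μ` in the weak* topology,
then `μ ∈ M(X,G)` and `limsup_i (1/|F_{n_i}|) ∫ f_{F_{n_i}} dν_{n_i} ≤ 𝓕_*(μ)`. -/
theorem averaged_integrals_limsup_le
    {G X : Type*} [CommGroup G] [Countable G] [DecidableEq G]
    [MetricSpace X] [CompactSpace X] [MeasurableSpace X] [BorelSpace X]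
    [MulAction G X] (hact : ∀ g : G, Continuous fun x : X => g • x)
    (f : Finset G → X → ℝ) (hf : SubaddPotential G f)
    (F : ℕ → Finset G) (hF : FolnerSeq G F)
    (htile : ∀ n, ∃ Ctr : Set G,
      (Ctr.PairwiseDisjoint fun c => (fun t => t * c) '' (↑(F n) : Set G)) ∧
      ⋃ c ∈ Ctr, (fun t => t * c) '' (↑(F n) : Set G) = Set.univ)
    (ν : ℕ → Measure X) (hν : ∀ n, IsProbabilityMeasure (ν n))
    (ns : ℕ → ℕ) (hns : StrictMono ns)
    (μ : Measure X)
    (hconv : ∀ φ : C(X, ℝ), Tendsto (fun i => ∫ x, φ x ∂(((F (ns i)).card : ℝ≥0∞)⁻¹ •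
        ∑ g ∈ F (ns i), Measure.map (fun x => g • x) (ν (ns i)))) atTop
      (𝓝 (∫ x, φ x ∂μ))) :
    GInvariant G μ ∧
    ∀ L : ℝ, Tendsto (fun n => (∫ x, f (F n) x ∂μ) / (F n).card) atTop (𝓝 L) →
      limsup (fun i => (∫ x, f (F (ns i)) x ∂(ν (ns i))) / (F (ns i)).card) atTop ≤ L := by
  have hconv' : ∀ φ : X → ℝ, Continuous φ → Tendsto (fun i =>
      (∑ g ∈ F (ns i), ∫ x, φ (g • x) ∂ν (ns i)) / (F (ns i)).card) atTop
        (𝓝 (∫ x, φ x ∂μ)) := fun φ hφ =>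
    (hconv ⟨φ, hφ⟩).congr fun i => integral_average_map hact _ _ hφ
  refine ⟨gInvariant_of_tendsto_average hact hF hν hns hconv', fun L hL => ?_⟩
  refine ge_of_tendsto' hL fun n => ?_
  obtain ⟨Ctr, hdisj, hcov⟩ := htile n
  exact hf.limsup_le_of_tile hact hF hν hns hconv' (hF.1 n) hdisj hcov
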